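/- For each i ∈ {0,1}, the function γ ↦ 1/√(3 + σ_i(γ)) is strictly decreasing on (0,∞), where σ_i(γ) = (γ·h_i(γ) + 4)/g_i(γ) + γ·h_i(γ) + 1 and g_i(γ) = γ²·(h_i(γ)² − 1) + (2i+1)·γ·h_i(γ) − 4. (This function is the dimensionless maximal characteristic velocity λ̃ = λ̂/c of the relativistic Euler system with Synge energy, so λ̃ decreases monotonically with the coldness parameter γ.) -/

import Mathlib

open MeasureTheory Real

/-- Modified Bessel function of the second kind of integer order `j`, via the integral
representation `K_j(γ) = (2^j j! / (2j)!) · γ^{-j} · ∫_γ^∞ e^{-λ} (λ² - γ²)^{j - 1/2} dλ`. -/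
noncomputable def besselK (j : ℕ) (γ : ℝ) : ℝ :=
  ((2 : ℝ) ^ j * (Nat.factorial j) / (Nat.factorial (2 * j)) / γ ^ j) *
    ∫ l in Set.Ioi γ, Real.exp (-l) * (l ^ 2 - γ ^ 2) ^ ((j : ℝ) - 1 / 2)

/-- The ratio `h_i(γ) = K_i(γ)/K_{i+1}(γ)`. -/
noncomputable def hRatio (i : ℕ) (γ : ℝ) : ℝ := besselK i γ / besselK (i + 1) γ

open Set Filter Topology

/-- The integral `∫_1^∞ u^k e^{-γu} (u² - 1)^{j - 1/2} du`. -/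
noncomputable def besselMoment (k j : ℕ) (γ : ℝ) : ℝ :=
  ∫ u in Ioi (1 : ℝ), u ^ k * (exp (-(γ * u)) * (u ^ 2 - 1) ^ ((j : ℝ) - 1 / 2))

theorem integrableOn_besselMoment (k j : ℕ) {γ : ℝ} (hγ : 0 < γ) :
    IntegrableOn (fun u : ℝ => u ^ k * (exp (-(γ * u)) * (u ^ 2 - 1) ^ ((j : ℝ) - 1 / 2)))
      (Ioi 1) := by
  have h0 := integrableOn_rpow_mul_exp_neg_mul_rpow (p := 1) (s := -(1 / 2)) (b := γ / 2)
    (by norm_num) one_pos (half_pos hγ)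
  have h1 : IntegrableOn
      (fun u : ℝ => (u - 1) ^ (-(1 / 2) : ℝ) * exp (-(γ / 2) * (u - 1) ^ (1 : ℝ))) (Ioi 1) := by
    have := (measurePreserving_sub_right volume (1 : ℝ)).integrableOn_comp_preimage
      (MeasurableEquiv.subRight (1 : ℝ)).measurableEmbedding (s := Ioi 0)
      (f := fun x : ℝ => x ^ (-(1 / 2) : ℝ) * exp (-(γ / 2) * x ^ (1 : ℝ)))
    simpa [Function.comp_def] using this.2 h0
  have hmeas : AEStronglyMeasurable
      (fun u : ℝ => u ^ k * (exp (-(γ * u)) * (u ^ 2 - 1) ^ ((j : ℝ) - 1 / 2)))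
      (volume.restrict (Ioi 1)) := by
    apply Measurable.aestronglyMeasurable; fun_prop
  refine Integrable.mono' (h1.const_mul ((2 * j + k).factorial / (γ / 2) ^ (2 * j + k))) hmeas ?_
  filter_upwards [ae_restrict_mem measurableSet_Ioi] with u (hu : 1 < u)
  have hu1 : 0 < u - 1 := by linarith
  have hu2 : 0 < u ^ 2 - 1 := by nlinarith
  rw [Real.norm_of_nonneg (by positivity), rpow_one]
  have e1 : (u ^ 2 - 1) ^ ((j : ℝ) - 1 / 2) ≤ u ^ (2 * j) * (u - 1) ^ (-(1 / 2) : ℝ) := by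
    rw [sub_eq_add_neg (j : ℝ), rpow_add hu2, rpow_natCast, pow_mul]
    gcongr ?_ * ?_
    · exact pow_le_pow_left₀ hu2.le (by linarith) _
    · exact rpow_le_rpow_of_nonpos hu1 (by nlinarith) (by norm_num)
  have e2 : u ^ (2 * j + k) ≤
      (2 * j + k).factorial / (γ / 2) ^ (2 * j + k) * exp (γ / 2 * u) := by
    have := pow_div_factorial_le_exp (γ / 2 * u) (by positivity) (2 * j + k)
    rw [div_le_iff₀ (by positivity), mul_pow] at this
    rw [div_mul_eq_mul_div, le_div_iff₀ (by positivity)]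
    linarith
  have e3 : exp (γ / 2 * u) * exp (-(γ * u)) ≤ exp (-(γ / 2) * (u - 1)) := by
    rw [← exp_add]; apply exp_le_exp.2; nlinarith
  calc u ^ k * (exp (-(γ * u)) * (u ^ 2 - 1) ^ ((j : ℝ) - 1 / 2))
      ≤ u ^ k * (exp (-(γ * u)) * (u ^ (2 * j) * (u - 1) ^ (-(1 / 2) : ℝ))) := by gcongr
    _ = u ^ (2 * j + k) * exp (-(γ * u)) * (u - 1) ^ (-(1 / 2) : ℝ) := by ring
    _ ≤ (2 * j + k).factorial / (γ / 2) ^ (2 * j + k) * exp (γ / 2 * u) * exp (-(γ * u))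
        * (u - 1) ^ (-(1 / 2) : ℝ) := by gcongr
    _ = (2 * j + k).factorial / (γ / 2) ^ (2 * j + k) * (exp (γ / 2 * u) * exp (-(γ * u)))
        * (u - 1) ^ (-(1 / 2) : ℝ) := by ring
    _ ≤ (2 * j + k).factorial / (γ / 2) ^ (2 * j + k) * exp (-(γ / 2) * (u - 1))
        * (u - 1) ^ (-(1 / 2) : ℝ) := by gcongr
    _ = _ := by ring

theorem besselMoment_pos (k j : ℕ) {γ : ℝ} (hγ : 0 < γ) : 0 < besselMoment k j γ := by
  have hpos : ∀ u ∈ Ioi (1 : ℝ),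
      0 < u ^ k * (exp (-(γ * u)) * (u ^ 2 - 1) ^ ((j : ℝ) - 1 / 2)) := by
    intro u (hu : 1 < u)
    have hu2 : 0 < u ^ 2 - 1 := by nlinarith
    positivity
  rw [besselMoment, setIntegral_pos_iff_support_of_nonneg_ae
    ((ae_restrict_mem measurableSet_Ioi).mono fun u hu => (hpos u hu).le)
    (integrableOn_besselMoment k j hγ),
    inter_eq_self_of_subset_right fun u hu => Function.mem_support.2 (hpos u hu).ne']
  simp

theorem hasDerivAt_besselMoment (k j : ℕ) {γ : ℝ} (hγ : 0 < γ) :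
    HasDerivAt (besselMoment k j) (-besselMoment (k + 1) j γ) γ := by
  have hmeas : ∀ (k : ℕ) (γ : ℝ), AEStronglyMeasurable
      (fun u : ℝ => u ^ k * (exp (-(γ * u)) * (u ^ 2 - 1) ^ ((j : ℝ) - 1 / 2)))
      (volume.restrict (Ioi 1)) := by
    intro k γ; apply Measurable.aestronglyMeasurable; fun_prop
  have := (hasDerivAt_integral_of_dominated_loc_of_deriv_le (μ := volume.restrict (Ioi (1 : ℝ)))
    (F := fun γ u => u ^ k * (exp (-(γ * u)) * (u ^ 2 - 1) ^ ((j : ℝ) - 1 / 2)))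
    (F' := fun γ u => -(u ^ (k + 1) * (exp (-(γ * u)) * (u ^ 2 - 1) ^ ((j : ℝ) - 1 / 2))))
    (bound := fun u =>
      u ^ (k + 1) * (exp (-(γ / 2 * u)) * (u ^ 2 - 1) ^ ((j : ℝ) - 1 / 2)))
    (Ioi_mem_nhds (half_lt_self hγ)) (Eventually.of_forall (hmeas k))
    (integrableOn_besselMoment k j hγ) (hmeas (k + 1) γ).neg ?_
    (integrableOn_besselMoment (k + 1) j (half_pos hγ)) ?_).2
  · rw [integral_neg] at this
    exact this
  · filter_upwards [ae_restrict_mem measurableSet_Ioi] with u (hu : 1 < u) x (hx : γ / 2 < x)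
    have hu2 : 0 < u ^ 2 - 1 := by nlinarith
    rw [norm_neg, Real.norm_of_nonneg (by positivity)]
    gcongr
  · filter_upwards with u x _
    have h := (((hasDerivAt_id x).mul_const u).neg.exp.mul_const
      ((u ^ 2 - 1) ^ ((j : ℝ) - 1 / 2))).const_mul (u ^ k)
    refine h.congr_deriv ?_
    simp only [id, Pi.neg_apply]
    ring

theorem hasDerivAt_sq_sub_one_rpow (j : ℕ) {u : ℝ} (hu : 1 < u) :
    HasDerivAt (fun u : ℝ => (u ^ 2 - 1) ^ (((j + 1 : ℕ) : ℝ) - 1 / 2))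
      ((2 * j + 1) * (u * (u ^ 2 - 1) ^ ((j : ℝ) - 1 / 2))) u := by
  have hu2 : 0 < u ^ 2 - 1 := by nlinarith
  have h := (((hasDerivAt_id u).pow 2).sub_const 1).rpow_const
    (p := ((j + 1 : ℕ) : ℝ) - 1 / 2) (Or.inl hu2.ne')
  refine h.congr_deriv ?_
  simp only [id, Pi.pow_apply, Nat.cast_add, Nat.cast_one]
  rw [show (j : ℝ) + 1 - 1 / 2 - 1 = j - 1 / 2 by ring]
  push_cast
  ring

theorem tendsto_besselMoment_integrand (k j : ℕ) {γ : ℝ} (hγ : 0 < γ) :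
    Tendsto (fun u : ℝ => u ^ k * (exp (-(γ * u)) * (u ^ 2 - 1) ^ (((j + 1 : ℕ) : ℝ) - 1 / 2)))
      atTop (𝓝 0) := by
  have h := (tendsto_pow_mul_exp_neg_atTop_nhds_zero (k + 2 * (j + 1))).comp
    (tendsto_id.const_mul_atTop hγ)
  have h := h.const_mul ((γ ^ (k + 2 * (j + 1)))⁻¹)
  rw [mul_zero] at h
  refine squeeze_zero' ?_ ?_ h
  · filter_upwards [eventually_gt_atTop 1] with u hu
    have hu2 : 0 < u ^ 2 - 1 := by nlinarith
    positivity
  · filter_upwards [eventually_gt_atTop 1] with u hu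
    have hu2 : 0 < u ^ 2 - 1 := by nlinarith
    have e : (u ^ 2 - 1) ^ (((j + 1 : ℕ) : ℝ) - 1 / 2) ≤ u ^ (2 * (j + 1)) := by
      calc (u ^ 2 - 1) ^ (((j + 1 : ℕ) : ℝ) - 1 / 2)
          ≤ (u ^ 2) ^ (((j + 1 : ℕ) : ℝ) - 1 / 2) := by
            gcongr
            · push_cast; linarith [(Nat.cast_nonneg j : (0 : ℝ) ≤ j)]
            · linarith
        _ ≤ (u ^ 2) ^ ((j + 1 : ℕ) : ℝ) := by
            gcongr
            · nlinarith
            · linarith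
        _ = u ^ (2 * (j + 1)) := by rw [rpow_natCast, pow_mul]
    calc u ^ k * (exp (-(γ * u)) * (u ^ 2 - 1) ^ (((j + 1 : ℕ) : ℝ) - 1 / 2))
        ≤ u ^ k * (exp (-(γ * u)) * u ^ (2 * (j + 1))) := by gcongr
      _ = _ := by
        simp only [Function.comp_apply, id, mul_pow, pow_add]
        field_simp

theorem besselMoment_succ_mul (k j : ℕ) {γ : ℝ} (hγ : 0 < γ) :
    γ * besselMoment k (j + 1) γ =
      k * besselMoment (k - 1) (j + 1) γ + (2 * j + 1) * besselMoment (k + 1) j γ := by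
  have h0 : (((j + 1 : ℕ) : ℝ) - 1 / 2) ≠ 0 := by
    push_cast; linarith [(Nat.cast_nonneg j : (0 : ℝ) ≤ j)]
  have i1 := (integrableOn_besselMoment k (j + 1) hγ).const_mul (-γ)
  have i2 := (integrableOn_besselMoment (k - 1) (j + 1) hγ).const_mul (k : ℝ)
  have i3 := (integrableOn_besselMoment (k + 1) j hγ).const_mul (2 * j + 1 : ℝ)
  have h := integral_Ioi_of_hasDerivAt_of_tendsto (a := (1 : ℝ))
    (f := fun u : ℝ =>
      u ^ k * (exp (-(γ * u)) * (u ^ 2 - 1) ^ (((j + 1 : ℕ) : ℝ) - 1 / 2)))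
    ?_ ?_ ((i1.add i2).add i3) (tendsto_besselMoment_integrand k j hγ)
  · rw [integral_add' (i1.add i2) i3, integral_add' i1 i2, integral_const_mul,
      integral_const_mul, integral_const_mul] at h
    simp only [one_pow, sub_self, zero_rpow h0, mul_zero] at h
    unfold besselMoment
    linarith
  · refine Continuous.continuousWithinAt ?_
    have : Continuous fun u : ℝ => (u ^ 2 - 1) ^ (((j + 1 : ℕ) : ℝ) - 1 / 2) :=
      Continuous.rpow_const (by fun_prop) fun _ => Or.inr (by
        push_cast; linarith [(Nat.cast_nonneg j : (0 : ℝ) ≤ j)])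
    fun_prop
  · intro u (hu : 1 < u)
    have h := (hasDerivAt_pow k u).mul
      ((((hasDerivAt_id u).const_mul γ).neg.exp).mul (hasDerivAt_sq_sub_one_rpow j hu))
    refine h.congr_deriv ?_
    simp only [id, Pi.neg_apply, Pi.add_apply, Pi.mul_apply]
    ring

theorem besselK_eq (j : ℕ) {γ : ℝ} (hγ : 0 < γ) :
    besselK j γ = (2 : ℝ) ^ j * j.factorial / (2 * j).factorial * γ ^ j * besselMoment 0 j γ := by
  have h := integral_comp_mul_left_Ioi'
    (fun l => exp (-l) * (l ^ 2 - γ ^ 2) ^ ((j : ℝ) - 1 / 2)) 1 hγ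
  rw [mul_one] at h
  rw [besselK, ← h, besselMoment]
  have : ∀ u ∈ Ioi (1 : ℝ), exp (-(γ * u)) * ((γ * u) ^ 2 - γ ^ 2) ^ ((j : ℝ) - 1 / 2) =
      γ ^ (2 * j) / γ * (u ^ 0 * (exp (-(γ * u)) * (u ^ 2 - 1) ^ ((j : ℝ) - 1 / 2))) := by
    intro u (hu : 1 < u)
    have hu2 : 0 < u ^ 2 - 1 := by nlinarith
    rw [show (γ * u) ^ 2 - γ ^ 2 = γ ^ 2 * (u ^ 2 - 1) by ring,
      mul_rpow (by positivity) hu2.le, rpow_sub (by positivity : 0 < γ ^ 2), rpow_natCast,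
      ← sqrt_eq_rpow, sqrt_sq hγ.le, pow_mul]
    ring
  rw [setIntegral_congr_fun measurableSet_Ioi this, integral_const_mul, smul_eq_mul, pow_mul']
  field_simp

theorem besselK_pos (j : ℕ) {γ : ℝ} (hγ : 0 < γ) : 0 < besselK j γ := by
  rw [besselK_eq j hγ]
  have := besselMoment_pos 0 j hγ
  positivity

theorem besselK_succ_eq (j : ℕ) {γ : ℝ} (hγ : 0 < γ) :
    besselK (j + 1) γ =
      (2 : ℝ) ^ j * j.factorial / (2 * j).factorial * γ ^ j * besselMoment 1 j γ := by
  have h := besselMoment_succ_mul 0 j hγ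
  simp only [Nat.cast_zero, zero_mul, zero_add] at h
  rw [besselK_eq _ hγ, pow_succ γ, mul_assoc, mul_assoc, h, show 2 * (j + 1) = 2 * j + 1 + 1 by ring,
    Nat.factorial_succ (2 * j + 1), Nat.factorial_succ (2 * j), Nat.factorial_succ j]
  push_cast
  field_simp
  ring

theorem hasDerivAt_besselK (j : ℕ) {γ : ℝ} (hγ : 0 < γ) :
    HasDerivAt (besselK j) (j / γ * besselK j γ - besselK (j + 1) γ) γ := by
  have h := ((hasDerivAt_pow j γ).const_mul
    ((2 : ℝ) ^ j * j.factorial / (2 * j).factorial)).mul (hasDerivAt_besselMoment 0 j hγ)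
  refine (h.congr_of_eventuallyEq ?_).congr_deriv ?_
  · filter_upwards [Ioi_mem_nhds hγ] with x hx using besselK_eq j hx
  · rw [besselK_eq j hγ, besselK_succ_eq j hγ]
    rcases j with _ | j
    · simp
    · simp only [Nat.add_sub_cancel, pow_succ]
      field_simp
      ring

theorem besselK_add_two (j : ℕ) {γ : ℝ} (hγ : 0 < γ) :
    besselK (j + 2) γ = besselK j γ + 2 * (j + 1) / γ * besselK (j + 1) γ := by
  have h1 := besselMoment_succ_mul 1 j hγ
  have h2 : besselMoment 2 j γ = besselMoment 0 (j + 1) γ + besselMoment 0 j γ := by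
    unfold besselMoment
    rw [← integral_add (integrableOn_besselMoment 0 (j + 1) hγ) (integrableOn_besselMoment 0 j hγ)]
    refine setIntegral_congr_fun measurableSet_Ioi fun u (hu : 1 < u) => ?_
    have hu2 : 0 < u ^ 2 - 1 := by nlinarith
    simp only [Nat.cast_add, Nat.cast_one]
    rw [show (j : ℝ) + 1 - 1 / 2 = (j - 1 / 2) + 1 by ring, rpow_add_one hu2.ne']
    ring
  simp only [Nat.sub_self, Nat.cast_one, one_mul, Nat.reduceAdd] at h1
  rw [h2] at h1
  rw [besselK_succ_eq (j + 1) hγ, besselK_eq (j + 1) hγ, besselK_eq j hγ,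
    show 2 * (j + 1) = 2 * j + 1 + 1 by ring,
    Nat.factorial_succ (2 * j + 1), Nat.factorial_succ (2 * j), Nat.factorial_succ j]
  push_cast
  field_simp
  have : γ * besselMoment 1 (j + 1) γ = (2 * j + 2) * besselMoment 0 (j + 1) γ
    + (2 * j + 1) * besselMoment 0 j γ := by linarith
  linear_combination 2 * 2 ^ j * γ ^ (j + 1) * (j + 1) * this

theorem tendsto_pow_mul_besselK (n j : ℕ) :
    Tendsto (fun γ => γ ^ n * besselK j γ) atTop (𝓝 0) := by
  have h := (tendsto_pow_mul_exp_neg_atTop_nhds_zero (n + j)).const_mul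
    ((2 : ℝ) ^ j * j.factorial / (2 * j).factorial * (exp 1 * besselMoment 0 j 1))
  rw [mul_zero] at h
  refine squeeze_zero' ?_ ?_ h
  · filter_upwards [eventually_gt_atTop 0] with γ hγ
    have := besselK_pos j hγ
    positivity
  · filter_upwards [eventually_ge_atTop 1] with γ hγ
    have hγ0 : 0 < γ := by linarith
    have hm : besselMoment 0 j γ ≤ exp 1 * exp (-γ) * besselMoment 0 j 1 := by
      unfold besselMoment
      rw [← integral_const_mul]
      refine setIntegral_mono_on (integrableOn_besselMoment 0 j hγ0)
        ((integrableOn_besselMoment 0 j one_pos).const_mul _) measurableSet_Ioi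
        fun u (hu : 1 < u) => ?_
      have hu2 : 0 < u ^ 2 - 1 := by nlinarith
      have he : exp (-(γ * u)) ≤ exp 1 * exp (-γ) * exp (-(1 * u)) := by
        rw [← exp_add, ← exp_add]; apply exp_le_exp.2; nlinarith
      rw [pow_zero, one_mul, one_mul, ← mul_assoc]
      gcongr
    rw [besselK_eq j hγ0]
    calc _ ≤ γ ^ n * ((2 : ℝ) ^ j * j.factorial / (2 * j).factorial * γ ^ j *
          (exp 1 * exp (-γ) * besselMoment 0 j 1)) := by gcongr
      _ = _ := by ring

/-- A function decreasing wherever it is nonpositive and with nonnegative lower limit at infinity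
is positive. -/
theorem pos_of_hasDerivAt_neg_of_nonpos {f f' : ℝ → ℝ}
    (hf : ∀ x > 0, HasDerivAt f (f' x) x) (hf' : ∀ x > 0, f x ≤ 0 → f' x < 0)
    (hlim : ∀ ε > 0, ∀ᶠ x in Filter.atTop, -ε < f x) {x : ℝ} (hx : 0 < x) : 0 < f x := by
  by_contra! hfx
  have key : ∀ {z : ℝ}, 0 < z → f z ≤ 0 → ∀ᶠ t in nhdsWithin z (Set.Ioi z), f t < f z := by
    intro z hz hfz
    have h := ((hasDerivAt_iff_tendsto_slope.1 (hf z hz)).mono_left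
      (nhdsWithin_mono z (fun t (ht : z < t) => ht.ne')))
    filter_upwards [h.eventually (gt_mem_nhds (hf' z hz hfz)), self_mem_nhdsWithin] with t ht hzt
    rw [slope_def_field, div_neg_iff] at ht
    have : z < t := hzt
    rcases ht with h | h <;> linarith [h.1, h.2]
  obtain ⟨x₁, hfx₁, hx₁⟩ := ((key hx hfx).and self_mem_nhdsWithin).exists
  replace hx₁ : x < x₁ := hx₁
  have hneg : f x₁ < 0 := by linarith
  obtain ⟨M, hM, hM₁⟩ :=
    ((hlim (-f x₁) (by linarith)).and (Filter.eventually_gt_atTop x₁)).exists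
  have hcont : ContinuousOn f (Set.Icc x₁ M) := fun t ht =>
    (hf t (by linarith [ht.1])).continuousAt.continuousWithinAt
  obtain ⟨m, hm, hmin⟩ := isCompact_Icc.exists_isMinOn (Set.nonempty_Icc.2 hM₁.le) hcont
  have hm₁ : f m ≤ f x₁ := hmin (Set.left_mem_Icc.2 hM₁.le)
  have hmM : m < M := lt_of_le_of_ne hm.2 (by rintro rfl; linarith)
  obtain ⟨t, ht, htm⟩ := ((key (by linarith [hm.1]) (by linarith)).and
    (Ioo_mem_nhdsGT hmM)).exists
  have : f m ≤ f t := hmin ⟨hm.1.trans htm.1.le, htm.2.le⟩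
  linarith

/-- Positivity of the numerator of the logarithmic derivative of `(y + 4) (1 - 1 / w)` along the
flow with `γ dy/dγ = y + 4 - w` and `w = γ² + 4 - y² - a y`. -/
theorem cubic_pos {a y w : ℝ} (ha : a = 1 ∨ a = 3) (hy : 0 < y)
    (hw : 4 - a * y / (2 * y + a) < w) (hw' : w < y + 4) :
    0 < (w ^ 2 - w) * (y + 4 - w)
      - (y + 4) * ((8 - a) * y + 4 * a + 8 - (2 * y + a + 2) * w) := by
  have ha0 : 0 < a := by rcases ha with rfl | rfl <;> norm_num
  set W := 4 - a * y / (2 * y + a) with hW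
  have hq : 0 < 2 * y + a := by positivity
  have hWq : W = ((8 - a) * y + 4 * a) / (2 * y + a) := by rw [hW]; field_simp; ring
  have hW4 : W ≤ 4 := by
    have : 0 < a * y / (2 * y + a) := by positivity
    linarith
  have hW0 : 0 < W := by
    rw [hWq]; apply div_pos _ hq
    rcases ha with rfl | rfl <;> linarith
  have hF : 0 ≤ (W ^ 2 - W) * (y + 4 - W)
      - (y + 4) * ((8 - a) * y + 4 * a + 8 - (2 * y + a + 2) * W) := by
    rw [hWq]
    rcases ha with rfl | rfl
    · have : 0 ≤ y * (31 * (2 * y + 1) ^ 3 + 19 * (2 * y + 1) ^ 2 + 13 * (2 * y + 1) + 1)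
        / (4 * (2 * y + 1) ^ 3) := by positivity
      refine this.trans_eq ?_
      field_simp
      ring
    · have : 0 ≤ y * (3 * (2 * y + 3) ^ 3 + 57 * (2 * y + 3) ^ 2 + 297 * (2 * y + 3) + 243)
        / (4 * (2 * y + 3) ^ 3) := by positivity
      refine this.trans_eq ?_
      field_simp
      ring
  have hQ : 0 < (1 + (y + 4)) * (w + W) - w ^ 2 - w * W - W ^ 2
      + (y + 4) * (2 * y + a + 1) := by
    have h1 : 0 < W * (y + 4 - W) := mul_pos hW0 (by linarith)
    have h2 : 0 < w * (y + 4 - w) := mul_pos (by linarith) (by linarith)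
    rcases ha with rfl | rfl <;> nlinarith [mul_pos hW0 (sub_pos.2 hw'),
      mul_pos (hW0.trans hw) (by linarith : 0 < y + 4 - W), mul_pos hy hW0]
  nlinarith [mul_pos (sub_pos.2 hw) hQ]

theorem hRatio_pos (i : ℕ) {γ : ℝ} (hγ : 0 < γ) : 0 < hRatio i γ :=
  div_pos (besselK_pos i hγ) (besselK_pos (i + 1) hγ)

theorem hasDerivAt_besselK_succ (i : ℕ) {γ : ℝ} (hγ : 0 < γ) :
    HasDerivAt (besselK (i + 1))
      (-((γ * hRatio i γ + (i + 1)) / γ * besselK (i + 1) γ)) γ := by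
  refine (hasDerivAt_besselK (i + 1) hγ).congr_deriv ?_
  have := besselK_pos (i + 1) hγ
  rw [besselK_add_two i hγ, hRatio]
  push_cast
  field_simp
  ring

/-- The Riccati equation for `y(γ) = γ h_i(γ)`. -/
theorem hasDerivAt_mul_hRatio (i : ℕ) {γ : ℝ} (hγ : 0 < γ) :
    HasDerivAt (fun γ => γ * hRatio i γ)
      (((γ * hRatio i γ) ^ 2 + (2 * (i : ℝ) + 2) * (γ * hRatio i γ) - γ ^ 2) / γ) γ := by
  have hB := besselK_pos (i + 1) hγ
  refine ((hasDerivAt_id γ).mul ((hasDerivAt_besselK i hγ).div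
    (hasDerivAt_besselK_succ i hγ) hB.ne')).congr_deriv ?_
  simp only [hRatio, id, Pi.div_apply]
  field_simp
  ring

theorem tendsto_mul_hRatio_mul_besselK (i : ℕ) (b : ℝ) :
    Tendsto (fun γ => ((γ * hRatio i γ) ^ 2 + b * (γ * hRatio i γ)) * besselK (i + 1) γ ^ 2)
      atTop (𝓝 0) := by
  have h1 := tendsto_pow_mul_besselK 1 i
  have h0 := tendsto_pow_mul_besselK 0 (i + 1)
  have h := (h1.mul h1).add ((h1.mul h0).const_mul b)
  simp only [mul_zero, add_zero] at h
  refine h.congr' ?_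
  filter_upwards [eventually_gt_atTop 0] with γ hγ
  have := besselK_pos (i + 1) hγ
  rw [hRatio]
  field_simp

theorem sq_lt_mul_hRatio (i : ℕ) {γ : ℝ} (hγ : 0 < γ) :
    γ ^ 2 < (γ * hRatio i γ) ^ 2 + (2 * (i : ℝ) + 2) * (γ * hRatio i γ) := by
  have key : 0 < ((γ * hRatio i γ) ^ 2 + (2 * (i : ℝ) + 2) * (γ * hRatio i γ) - γ ^ 2)
      * besselK (i + 1) γ ^ 2 := by
    refine pos_of_hasDerivAt_neg_of_nonpos
      (f := fun γ => ((γ * hRatio i γ) ^ 2 + (2 * (i : ℝ) + 2) * (γ * hRatio i γ) - γ ^ 2)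
        * besselK (i + 1) γ ^ 2)
      (f' := fun γ => -(2 * γ * besselK (i + 1) γ ^ 2)) ?_ ?_ ?_ hγ
    · intro x hx
      have hy := hasDerivAt_mul_hRatio i hx
      refine ((((hy.pow 2).add (hy.const_mul (2 * (i : ℝ) + 2))).sub (hasDerivAt_pow 2 x)).mul
        ((hasDerivAt_besselK_succ i hx).pow 2)).congr_deriv ?_
      simp only [Pi.pow_apply, Pi.add_apply, Pi.sub_apply]
      field_simp
      push_cast
      ring
    · intro x hx _
      have := besselK_pos (i + 1) hx
      have : 0 < 2 * x * besselK (i + 1) x ^ 2 := by positivity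
      linarith
    · intro ε hε
      have h1 := tendsto_mul_hRatio_mul_besselK i (2 * (i : ℝ) + 2)
      have h2 := tendsto_pow_mul_besselK 1 (i + 1)
      have h := h1.sub (h2.mul h2)
      simp only [mul_zero, sub_zero] at h
      filter_upwards [h.eventually (lt_mem_nhds (neg_lt_zero.2 hε))] with x hx
      linarith
  have := pos_of_mul_pos_left key (by positivity)
  linarith

/-- The quantity `-g_i(γ)` stays above the barrier `4 - a y / (2 y + a)`, where `a = 2i + 1`. -/
theorem barrier_lt_neg_g (i : ℕ) {γ : ℝ} (hγ : 0 < γ) :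
    4 - (2 * (i : ℝ) + 1) * (γ * hRatio i γ) / (2 * (γ * hRatio i γ) + (2 * (i : ℝ) + 1)) <
      γ ^ 2 + 4 - (γ * hRatio i γ) ^ 2 - (2 * (i : ℝ) + 1) * (γ * hRatio i γ) := by
  set a : ℝ := 2 * (i : ℝ) + 1 with ha
  have ha0 : 0 < a := by positivity
  have key : 0 < (γ ^ 2 - (γ * hRatio i γ) ^ 2 - a * (γ * hRatio i γ)
      + a * (γ * hRatio i γ) / (2 * (γ * hRatio i γ) + a)) * besselK (i + 1) γ ^ 2 := by
    refine pos_of_hasDerivAt_neg_of_nonpos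
      (f := fun γ => (γ ^ 2 - (γ * hRatio i γ) ^ 2 - a * (γ * hRatio i γ)
        + a * (γ * hRatio i γ) / (2 * (γ * hRatio i γ) + a)) * besselK (i + 1) γ ^ 2)
      (f' := fun γ => ((γ ^ 2 - (γ * hRatio i γ) ^ 2 - a * (γ * hRatio i γ)
        + a * (γ * hRatio i γ) / (2 * (γ * hRatio i γ) + a))
          * (1 - a ^ 2 / (2 * (γ * hRatio i γ) + a) ^ 2)
        - a * (2 * (γ * hRatio i γ)) ^ 2 * (2 * (γ * hRatio i γ) + a + a / 2)
          / (2 * (γ * hRatio i γ) + a) ^ 3) / γ * besselK (i + 1) γ ^ 2) ?_ ?_ ?_ hγ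
    · intro x hx
      have hy := hasDerivAt_mul_hRatio i hx
      have hy0 : 0 < x * hRatio i x := mul_pos hx (hRatio_pos i hx)
      have hq : 0 < 2 * (x * hRatio i x) + a := by positivity
      refine (((((hasDerivAt_pow 2 x).sub (hy.pow 2)).sub (hy.const_mul a)).add
        ((hy.const_mul a).div ((hy.const_mul 2).add_const a) hq.ne')).mul
        ((hasDerivAt_besselK_succ i hx).pow 2)).congr_deriv ?_
      simp only [Pi.pow_apply, Pi.add_apply, Pi.sub_apply, Pi.div_apply]
      rw [show (i : ℝ) = (a - 1) / 2 by rw [ha]; ring]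
      generalize x * hRatio i x = y at *
      field_simp
      push_cast
      ring
    · intro x hx hf
      have hB := besselK_pos (i + 1) hx
      have hy0 : 0 < x * hRatio i x := mul_pos hx (hRatio_pos i hx)
      have hv := nonpos_of_mul_nonpos_left hf (by positivity)
      generalize x * hRatio i x = y at *
      have hq : 0 < 2 * y + a := by positivity
      have h1 : 0 ≤ 1 - a ^ 2 / (2 * y + a) ^ 2 := by
        rw [sub_nonneg, div_le_one (by positivity)]
        gcongr
        linarith
      have h2 : 0 < a * (2 * y) ^ 2 * (2 * y + a + a / 2) / (2 * y + a) ^ 3 := by positivity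
      have h3 := mul_nonpos_of_nonpos_of_nonneg hv h1
      exact mul_neg_of_neg_of_pos (div_neg_of_neg_of_pos (by linarith) hx) (by positivity)
    · intro ε hε
      have h := (tendsto_mul_hRatio_mul_besselK i a).eventually (gt_mem_nhds hε)
      filter_upwards [h, eventually_gt_atTop 0] with x hx hx0
      have hy0 : 0 < x * hRatio i x := mul_pos hx0 (hRatio_pos i hx0)
      generalize x * hRatio i x = y at *
      have : 0 ≤ (x ^ 2 + a * y / (2 * y + a)) * besselK (i + 1) x ^ 2 := by positivity
      linarith
  have := pos_of_mul_pos_left key (by positivity)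
  linarith

theorem one_lt_neg_g (i : ℕ) (hi : i = 0 ∨ i = 1) {γ : ℝ} (hγ : 0 < γ) :
    1 < γ ^ 2 + 4 - (γ * hRatio i γ) ^ 2 - (2 * (i : ℝ) + 1) * (γ * hRatio i γ) := by
  have hy0 : 0 < γ * hRatio i γ := mul_pos hγ (hRatio_pos i hγ)
  refine lt_trans ?_ (barrier_lt_neg_g i hγ)
  generalize γ * hRatio i γ = y at *
  have : (2 * (i : ℝ) + 1) * y / (2 * y + (2 * (i : ℝ) + 1)) < 3 := by
    rw [div_lt_iff₀ (by positivity)]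
    rcases hi with rfl | rfl <;> push_cast <;> linarith
  linarith

theorem strictMonoOn_three_add_sigma (i : ℕ) (hi : i = 0 ∨ i = 1) :
    StrictMonoOn (fun γ => (γ * hRatio i γ + 4) * (1 - 1 / (γ ^ 2 + 4 - (γ * hRatio i γ) ^ 2
      - (2 * (i : ℝ) + 1) * (γ * hRatio i γ)))) (Ioi 0) := by
  have hd : ∀ x ∈ Ioi (0 : ℝ), ∃ d > 0, HasDerivAt
      (fun γ => (γ * hRatio i γ + 4) * (1 - 1 / (γ ^ 2 + 4 - (γ * hRatio i γ) ^ 2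
        - (2 * (i : ℝ) + 1) * (γ * hRatio i γ)))) d x := by
    intro x (hx : 0 < x)
    have hy := hasDerivAt_mul_hRatio i hx
    have hy0 : 0 < x * hRatio i x := mul_pos hx (hRatio_pos i hx)
    have hw := one_lt_neg_g i hi hx
    have hw0 := (zero_lt_one.trans hw).ne'
    have hbar := barrier_lt_neg_g i hx
    have hsq := sq_lt_mul_hRatio i hx
    have hd := (hy.add_const 4).mul (((((hasDerivAt_pow 2 x).add_const 4).sub (hy.pow 2)).sub
      (hy.const_mul (2 * (i : ℝ) + 1))).fun_inv hw0 |>.const_sub 1)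
    simp only [Pi.pow_apply, Pi.sub_apply, ← one_div] at hd
    refine ⟨_, ?_, hd⟩
    have hcubic := cubic_pos (a := 2 * (i : ℝ) + 1)
      (by rcases hi with rfl | rfl <;> norm_num) hy0 hbar (by linarith)
    generalize x * hRatio i x = y at *
    have hpos := div_pos hcubic (mul_pos hx (pow_pos (zero_lt_one.trans hw) 2))
    refine hpos.trans_eq ?_
    obtain ⟨w, hwy⟩ : ∃ w, w = x ^ 2 + 4 - y ^ 2 - (2 * (i : ℝ) + 1) * y := ⟨_, rfl⟩
    rw [← hwy] at hw0 ⊢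
    field_simp
    rw [hwy]
    push_cast
    ring
  refine strictMonoOn_of_deriv_pos (convex_Ioi 0) ?_ ?_
  · intro x hx
    obtain ⟨d, _, h⟩ := hd x hx
    exact h.continuousAt.continuousWithinAt
  · intro x hx
    rw [interior_Ioi] at hx
    obtain ⟨d, hpos, h⟩ := hd x hx
    rwa [h.deriv]

/-- For `i ∈ {0,1}`, the dimensionless maximal characteristic velocity
`γ ↦ 1/√(3 + σ_i(γ))` is strictly decreasing on `(0,∞)`. -/
theorem charVelocity_strictAntiOn (i : ℕ) (hi : i = 0 ∨ i = 1) :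
    StrictAntiOn (fun γ : ℝ =>
      1 / Real.sqrt (3 +
        ((γ * hRatio i γ + 4) /
            (γ ^ 2 * (hRatio i γ ^ 2 - 1) + (2 * (i : ℝ) + 1) * γ * hRatio i γ - 4)
          + γ * hRatio i γ + 1))) (Set.Ioi 0) := by
  have hsigma : ∀ γ ∈ Ioi (0 : ℝ), 3 +
        ((γ * hRatio i γ + 4) /
            (γ ^ 2 * (hRatio i γ ^ 2 - 1) + (2 * (i : ℝ) + 1) * γ * hRatio i γ - 4)
          + γ * hRatio i γ + 1) =
      (γ * hRatio i γ + 4) * (1 - 1 / (γ ^ 2 + 4 - (γ * hRatio i γ) ^ 2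
        - (2 * (i : ℝ) + 1) * (γ * hRatio i γ))) := by
    intro γ _
    rw [show γ ^ 2 * (hRatio i γ ^ 2 - 1) + (2 * (i : ℝ) + 1) * γ * hRatio i γ - 4 =
      -(γ ^ 2 + 4 - (γ * hRatio i γ) ^ 2 - (2 * (i : ℝ) + 1) * (γ * hRatio i γ)) by ring,
      div_neg]
    ring
  intro x hx z hz hxz
  have hlt := strictMonoOn_three_add_sigma i hi hx hz hxz
  have hpos : 0 < (x * hRatio i x + 4) * (1 - 1 / (x ^ 2 + 4 - (x * hRatio i x) ^ 2
      - (2 * (i : ℝ) + 1) * (x * hRatio i x))) := by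
    have hw := one_lt_neg_g i hi hx
    refine mul_pos (by linarith [mul_pos hx (hRatio_pos i hx)]) (sub_pos.2 ?_)
    exact (div_lt_one (zero_lt_one.trans hw)).2 hw
  dsimp only
  rw [hsigma x hx, hsigma z hz]
  exact one_div_lt_one_div_of_lt (sqrt_pos.2 hpos) (sqrt_lt_sqrt hpos.le hlt)
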